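/- Let X₁, X₂, Y₁, Y₂ be natural numbers. Then g(X₁, X₂, Y₁, Y₂) = 0 if and only if either (sin X₁ < sin X₂ and {X₁, X₂} = {Y₁, Y₂} as sets) or (X₁ = X₂ and Y₁ = Y₂). -/

import Mathlib

noncomputable def gFn (X₁ X₂ Y₁ Y₂ : ℕ) : ℝ :=
  abs (Real.sin X₂ - Real.sin X₁ - abs (Real.sin Y₂ - Real.sin Y₁))


open Polynomial in
/-- The values of integer polynomials at integer multiples of `I` are Gaussian integers. -/
theorem exists_int_aeval_int_mul_I (g : ℤ[X]) (k : ℤ) :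
    ∃ a b : ℤ, aeval ((k : ℂ) * Complex.I) g = a + b * Complex.I := by
  induction g using Polynomial.induction_on' with
  | add p q hp hq =>
    obtain ⟨a, b, h⟩ := hp
    obtain ⟨c, d, h'⟩ := hq
    refine ⟨a + c, b + d, ?_⟩
    rw [map_add, h, h']
    push_cast
    ring
  | monomial n c =>
    have key : ∃ a b : ℤ, ((k : ℂ) * Complex.I) ^ n = a + b * Complex.I := by
      induction n with
      | zero => exact ⟨1, 0, by simp⟩
      | succ n ih =>
        obtain ⟨a, b, h⟩ := ih
        refine ⟨-(b * k), a * k, ?_⟩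
        rw [pow_succ, h]
        push_cast
        linear_combination (b * k : ℂ) * Complex.I_mul_I
    obtain ⟨a, b, h⟩ := key
    refine ⟨c * a, c * b, ?_⟩
    rw [aeval_monomial, h]
    simp
    ring

open Polynomial in
/-- `exp I` is not a root of an integer polynomial with nonzero constant coefficient. -/
theorem aeval_exp_I_ne_zero_of_coeff_zero_ne_zero (P : ℤ[X]) (hP : P.coeff 0 ≠ 0) :
    aeval (Complex.exp Complex.I) P ≠ 0 := by
  intro hroot
  set N := P.natDegree
  set f : ℤ[X] := ∏ k ∈ Finset.range N, (X ^ 2 + C (((k : ℤ) + 1) ^ 2)) with hf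
  have hf0 : f.eval 0 ≠ 0 := by
    rw [hf, eval_prod, Finset.prod_ne_zero_iff]
    intro k _
    simp
    positivity
  have hfne : f ≠ 0 := by
    rintro h
    simp [h] at hf0
  have hfroot (k : ℕ) (hk : k < N) :
      (((k + 1 : ℕ) : ℤ) : ℂ) * Complex.I ∈ f.aroots ℂ := by
    rw [mem_aroots]
    refine ⟨hfne, ?_⟩
    rw [hf, map_prod]
    refine Finset.prod_eq_zero (Finset.mem_range.2 hk) ?_
    simp only [map_add, map_pow, aeval_X, eq_intCast, map_intCast]
    push_cast
    linear_combination ((k : ℂ) + 1) ^ 2 * Complex.I_sq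
  obtain ⟨c, hc⟩ := LindemannWeierstrass.exp_polynomial_approx f hf0
  set S : ℝ := ∑ k ∈ Finset.range N, |(P.coeff (k + 1) : ℝ)| with hS
  have hlim : Filter.Tendsto (fun q : ℕ => S * (c * (c ^ q / (q.factorial : ℝ))))
      Filter.atTop (nhds 0) := by
    simpa using ((FloorSemiring.tendsto_pow_div_factorial_atTop c).const_mul c).const_mul S
  obtain ⟨q₀, hq₀⟩ := Filter.eventually_atTop.1 (hlim.eventually_lt_const one_pos)
  obtain ⟨p, hple, hp⟩ := Nat.exists_infinite_primes
    (q₀ + 1 + (f.eval 0).natAbs + 1 + (P.coeff 0).natAbs + 1)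
  obtain ⟨n, hpn, g, -, hg⟩ := hc p (by omega) hp
  choose a b hab using fun k : ℕ => exists_int_aeval_int_mul_I g ((k + 1 : ℕ) : ℤ)
  set W : ℤ := n * P.coeff 0 + p * ∑ k ∈ Finset.range N, P.coeff (k + 1) * a k with hW
  have hWne : W ≠ 0 := by
    intro h0
    have hdvd : (p : ℤ) ∣ n * P.coeff 0 :=
      (Int.dvd_iff_dvd_of_dvd_add (by rw [← hW, h0]; exact dvd_zero _)).2 (dvd_mul_right _ _)
    rcases (Nat.prime_iff_prime_int.1 hp).dvd_or_dvd hdvd with h | h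
    · exact hpn h
    · have := Nat.le_of_dvd (Int.natAbs_pos.2 hP) (Int.natCast_dvd.1 h)
      omega
  have hsum : (P.coeff 0 : ℂ) + ∑ k ∈ Finset.range N, (P.coeff (k + 1) : ℂ) *
      Complex.exp ((((k + 1 : ℕ) : ℤ) : ℂ) * Complex.I) = 0 := by
    rw [aeval_eq_sum_range, Finset.sum_range_succ'] at hroot
    rw [← hroot, add_comm]
    congr 1
    · refine Finset.sum_congr rfl fun k _ => ?_
      rw [zsmul_eq_mul, ← Complex.exp_nat_mul]
      simp
    · simp
  have hWbound : (|W| : ℝ) ≤ S * (c ^ p / ((p - 1).factorial : ℝ)) := by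
    have hre : (W : ℝ) = (-∑ k ∈ Finset.range N, (P.coeff (k + 1) : ℂ) *
        (n • Complex.exp ((((k + 1 : ℕ) : ℤ) : ℂ) * Complex.I)
          - p • aeval ((((k + 1 : ℕ) : ℤ) : ℂ) * Complex.I) g)).re := by
      have h : -∑ k ∈ Finset.range N, (P.coeff (k + 1) : ℂ) *
          (n • Complex.exp ((((k + 1 : ℕ) : ℤ) : ℂ) * Complex.I)
            - p • aeval ((((k + 1 : ℕ) : ℤ) : ℂ) * Complex.I) g)
          = n * P.coeff 0 + p * ∑ k ∈ Finset.range N,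
            (P.coeff (k + 1) : ℂ) * (a k + b k * Complex.I) := by
        simp only [hab, mul_sub, Finset.sum_sub_distrib, zsmul_eq_mul, nsmul_eq_mul]
        simp only [mul_left_comm _ (n : ℂ), mul_left_comm _ (p : ℂ), ← Finset.mul_sum]
        linear_combination (-n : ℂ) * hsum
      rw [h, hW]
      simp [Complex.re_sum]
    rw [hre]
    refine (Complex.abs_re_le_norm _).trans ?_
    rw [norm_neg, hS, Finset.sum_mul]
    refine norm_sum_le_of_le _ fun k hk => ?_
    rw [norm_mul, Complex.norm_intCast]
    exact mul_le_mul_of_nonneg_left (hg (hfroot k (Finset.mem_range.1 hk))) (abs_nonneg _)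
  have hlt := hq₀ (p - 1) (by omega)
  rw [← mul_div_assoc, ← pow_succ', Nat.sub_add_cancel hp.one_le] at hlt
  have hone : (1 : ℝ) ≤ |(W : ℝ)| := by
    exact_mod_cast Int.one_le_abs hWne
  linarith

open Polynomial in
/-- `exp I` is transcendental, a special case of the Lindemann–Weierstrass theorem. -/
theorem transcendental_exp_I : Transcendental ℤ (Complex.exp Complex.I) := by
  rw [transcendental_iff]
  intro P hroot
  by_contra hP
  obtain ⟨Q, hPQ, hQ⟩ := exists_eq_pow_rootMultiplicity_mul_and_not_dvd P hP 0
  rw [C_0, sub_zero] at hPQ hQ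
  rw [X_dvd_iff] at hQ
  rw [hPQ, map_mul, map_pow, aeval_X] at hroot
  exact (mul_eq_zero.1 hroot).elim (pow_ne_zero _ (Complex.exp_ne_zero _))
    (aeval_exp_I_ne_zero_of_coeff_zero_ne_zero Q hQ)

open Polynomial in
theorem aeval_exp_I_X_pow_sub_X_pow {M n : ℕ} (h : n ≤ M) :
    aeval (Complex.exp Complex.I) (X ^ (M + n) - X ^ (M - n) : ℤ[X]) =
      Complex.exp Complex.I ^ M * (2 * Complex.I * (Real.sin n : ℂ)) := by
  obtain ⟨m, rfl⟩ := Nat.exists_eq_add_of_le' h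
  have hexp : Complex.exp Complex.I ^ n * Complex.exp (-n * Complex.I) = 1 := by
    rw [← Complex.exp_nat_mul, ← Complex.exp_add]
    simp
  have hsin : 2 * Complex.I * (Real.sin n : ℂ) =
      Complex.exp Complex.I ^ n - Complex.exp (-n * Complex.I) := by
    rw [Complex.ofReal_sin, Complex.sin, ← Complex.exp_nat_mul, Complex.ofReal_natCast]
    linear_combination (Complex.exp (-n * Complex.I) - Complex.exp (n * Complex.I)) *
      Complex.I_mul_I
  rw [hsin, Nat.add_sub_cancel]
  simp only [pow_add, map_sub, map_mul, map_pow, aeval_X]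
  linear_combination Complex.exp Complex.I ^ m * hexp

open Polynomial in
/-- The sines of natural numbers satisfy only the trivial four-term additive relations. -/
theorem Real.sin_natCast_add_sin_natCast_eq_iff (a b c d : ℕ) :
    Real.sin a + Real.sin b = Real.sin c + Real.sin d ↔
      (a = c ∧ b = d) ∨ (a = d ∧ b = c) := by
  refine ⟨fun h => ?_, ?_⟩
  · set M := a + b + c + d with hM
    set s : ℕ → ℤ[X] := fun n => X ^ (M + n) - X ^ (M - n) with hs
    have hzero : s a + s b - s c - s d = 0 := by
      refine transcendental_iff.1 transcendental_exp_I _ ?_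
      have h' : (Real.sin a : ℂ) + Real.sin b = Real.sin c + Real.sin d := by exact_mod_cast h
      rw [map_sub, map_sub, map_add, hs, aeval_exp_I_X_pow_sub_X_pow (by omega),
        aeval_exp_I_X_pow_sub_X_pow (by omega), aeval_exp_I_X_pow_sub_X_pow (by omega),
        aeval_exp_I_X_pow_sub_X_pow (by omega)]
      linear_combination Complex.exp Complex.I ^ M * (2 * Complex.I) * h'
    have hcoeff (n k : ℕ) (hk : k ≠ 0) : (s n).coeff (M + k) = if k = n then 1 else 0 := by
      have hne : M + k ≠ M - n := by omega
      simp [hs, coeff_X_pow, hne]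
    have hcount (k : ℕ) (hk : k ≠ 0) : ((if k = a then 1 else 0) + (if k = b then 1 else 0)
        - (if k = c then 1 else 0) - (if k = d then 1 else 0) : ℤ) = 0 := by
      have := congrArg (fun q => coeff q (M + k)) hzero
      simpa only [coeff_sub, coeff_add, hcoeff _ k hk, coeff_zero] using this
    have ha := hcount a
    have hb := hcount b
    have hc := hcount c
    have hd := hcount d
    clear_value M
    clear hcount hcoeff hzero hs h hM s
    grind
  · rintro (⟨rfl, rfl⟩ | ⟨rfl, rfl⟩)
    · rfl
    · exact add_comm _ _

/-- **Lemma 3.8.** `g (X₁, X₂, Y₁, Y₂) = 0` iff either `sin X₁ < sin X₂` and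
`{X₁, X₂} = {Y₁, Y₂}` as sets, or `X₁ = X₂` and `Y₁ = Y₂`. -/
theorem gFn_eq_zero_iff (X₁ X₂ Y₁ Y₂ : ℕ) :
    gFn X₁ X₂ Y₁ Y₂ = 0 ↔
      (Real.sin X₁ < Real.sin X₂ ∧ ({X₁, X₂} : Set ℕ) = {Y₁, Y₂}) ∨
        (X₁ = X₂ ∧ Y₁ = Y₂) := by
  rw [gFn, abs_eq_zero, sub_eq_zero, Set.pair_eq_pair_iff]
  constructor
  · intro h
    have hle : Real.sin X₁ ≤ Real.sin X₂ := sub_nonneg.1 (h ▸ abs_nonneg _)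
    have hsin : X₁ ≠ X₂ → Real.sin X₁ < Real.sin X₂ := fun hne =>
      hle.lt_of_ne fun heq => hne <| by
        have := (Real.sin_natCast_add_sin_natCast_eq_iff X₁ X₁ X₂ X₂).1 (by rw [heq])
        tauto
    rcases abs_choice (Real.sin Y₂ - Real.sin Y₁) with h' | h' <;> rw [h'] at h
    · have := (Real.sin_natCast_add_sin_natCast_eq_iff X₂ Y₁ X₁ Y₂).1 (by linarith)
      grind
    · have := (Real.sin_natCast_add_sin_natCast_eq_iff X₂ Y₂ X₁ Y₁).1 (by linarith)
      grind
  · rintro (⟨hlt, ⟨rfl, rfl⟩ | ⟨rfl, rfl⟩⟩ | ⟨rfl, rfl⟩)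
    · rw [abs_of_pos (sub_pos.2 hlt)]
    · rw [abs_sub_comm, abs_of_pos (sub_pos.2 hlt)]
    · simp
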